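/- (Proposition 3, corollary: the booklet 3-web W₁ of a WDVV solution is hexagonal.) Let U ⊆ ℂ × ℂ be open and f : U → ℂ holomorphic with f_{yyy} + f_{xxx}·f_{xyy} − f_{xxy}² = 0 on U. With a₀ := f_{xyy}, a₁ := 2f_{xxy}, a₂ := f_{xxx}, a₃ := −1, define Δ, DA, DB by Δ := −4a₀a₂³ + 18a₀a₁a₂a₃ − 27a₀²a₃² + a₁²a₂² − 4a₁³a₃, DA := a₃(2a₂² − 6a₁a₃)∂y a₀ + a₃(9a₀a₃ − a₁a₂)(∂x a₀ + ∂y a₁) + a₃(2a₁² − 6a₀a₂)(∂x a₁ + ∂y a₂) + (4a₀a₂² − a₁²a₂ − 3a₀a₁a₃)(∂x a₂ + ∂y a₃) + (18a₀²a₃ − 8a₀a₁a₂ + 2a₁³)∂x a₃, DB := (18a₀a₃² − 8a₁a₂a₃ + 2a₂³)∂y a₀ + (4a₁²a₃ − a₁a₂² − 3a₀a₂a₃)(∂x a₀ + ∂y a₁) + a₀(2a₂² − 6a₁a₃)(∂x a₁ + ∂y a₂) + a₀(9a₀a₃ − a₁a₂)(∂x a₂ + ∂y a₃) + a₀(2a₁²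 − 6a₀a₂)∂x a₃. Then on U: (1) 2·DA + ∂xΔ = 0 and 2·DB + ∂yΔ = 0; and (2) on the open set {z ∈ U : Δ(z) ≠ 0}, the curvature vanishes: ∂x(DB/Δ) − ∂y(DA/Δ) = 0. -/

import Mathlib

/-- Partial derivative in the x-direction on `ℂ × ℂ`. -/
noncomputable def pdx (f : ℂ × ℂ → ℂ) (z : ℂ × ℂ) : ℂ := fderiv ℂ f z (1, 0)

/-- Partial derivative in the y-direction on `ℂ × ℂ`. -/
noncomputable def pdy (f : ℂ × ℂ → ℂ) (z : ℂ × ℂ) : ℂ := fderiv ℂ f z (0, 1)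

open Metric Set Filter Topology

/-- A directional derivative of a holomorphic function of several complex variables is
holomorphic. -/
theorem differentiableOn_fderiv_apply {E : Type*} [NormedAddCommGroup E]
    [NormedSpace ℂ E] [FiniteDimensional ℂ E] {U : Set E} {f : E → ℂ}
    (hf : DifferentiableOn ℂ f U) (hU : IsOpen U) (v : E) :
    DifferentiableOn ℂ (fun z => fderiv ℂ f z v) U := by
  intro z₀ hz₀
  refine DifferentiableAt.differentiableWithinAt ?_
  have : ProperSpace E := FiniteDimensional.proper ℂ E
  have : ProperSpace (E →L[ℂ] ℂ) := FiniteDimensional.proper ℂ (E →L[ℂ] ℂ)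
  borelize E
  obtain ⟨R, hR, hRU, hRf⟩ : ∃ R > 0, ball z₀ R ⊆ U ∧ ∀ z ∈ ball z₀ R, dist (f z) (f z₀) < 1 := by
    have hc : ∀ᶠ z in 𝓝 z₀, z ∈ U ∧ dist (f z) (f z₀) < 1 :=
      (hU.eventually_mem hz₀).and
        ((hf.continuousOn.continuousAt (hU.mem_nhds hz₀)).eventually (ball_mem_nhds _ one_pos))
    obtain ⟨R, hR, h⟩ := Metric.eventually_nhds_iff_ball.1 hc
    exact ⟨R, hR, fun z hz => (h z hz).1, fun z hz => (h z hz).2⟩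
  have hfderiv : ∀ z ∈ ball z₀ (R / 2), ‖fderiv ℂ f z‖ ≤ 2 / (R / 2) := by
    intro z hz
    have hsub : ball z (R / 2) ⊆ ball z₀ R :=
      ball_subset_ball' (by linarith [mem_ball.1 hz])
    refine Complex.norm_fderiv_le_div_of_mapsTo_ball (hf.mono (hsub.trans hRU)) ?_ (by positivity)
    intro w hw
    have h₁ := hRf w (hsub hw)
    have h₂ := hRf z (hsub (mem_ball_self (by positivity)))
    rw [mem_closedBall]
    linarith [dist_triangle_right (f w) (f z) (f z₀)]
  set r : ℝ := R / (4 * (‖v‖ + 1)) with hr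
  have hr₀ : 0 < r := by positivity
  have hrv : r * ‖v‖ < R / 4 := by
    rw [hr, div_mul_eq_mul_div, div_lt_div_iff₀ (by positivity) (by norm_num)]
    nlinarith [norm_nonneg v]
  have hmem : ∀ z ∈ ball z₀ (R / 4), ∀ t ∈ closedBall (0 : ℂ) r, z + t • v ∈ ball z₀ (R / 2) := by
    intro z hz t ht
    rw [mem_ball_iff_norm] at hz ⊢
    rw [mem_closedBall_zero_iff] at ht
    calc ‖z + t • v - z₀‖ = ‖(z - z₀) + t • v‖ := by congr 1; abel
      _ ≤ ‖z - z₀‖ + ‖t‖ * ‖v‖ := (norm_add_le _ _).trans_eq (by rw [norm_smul])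
      _ ≤ ‖z - z₀‖ + r * ‖v‖ := by gcongr
      _ < R / 2 := by linarith
  have hdiff : ∀ z ∈ ball z₀ (R / 2), DifferentiableAt ℂ f z := fun z hz =>
    hf.differentiableAt (hU.mem_nhds (hRU (ball_subset_ball (by linarith) hz)))
  have hcircle : ∀ θ : ℝ, circleMap 0 r θ ∈ closedBall (0 : ℂ) r :=
    circleMap_mem_closedBall 0 hr₀.le
  set k : ℝ → ℂ := fun θ => deriv (circleMap 0 r) θ * (1 / (circleMap 0 r θ - 0) ^ 2) with hk
  have hk_norm : ∀ θ, ‖k θ‖ = 1 / r := by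
    intro θ
    simp [hk, abs_of_pos hr₀]
    field_simp
  have hk_cont : Continuous k := by
    have hne : ∀ θ, (circleMap 0 r θ - 0) ^ 2 ≠ 0 := fun θ =>
      pow_ne_zero 2 (sub_ne_zero.2 (circleMap_ne_center hr₀.ne'))
    simp only [hk, deriv_circleMap]
    fun_prop (disch := exact hne _)
  have hF_cont : ∀ z ∈ ball z₀ (R / 4),
      Continuous fun θ : ℝ => k θ * f (z + circleMap 0 r θ • v) := by
    intro z hz
    refine hk_cont.mul (continuous_iff_continuousAt.2 fun θ => ?_)
    exact ContinuousAt.comp (f := fun θ : ℝ => z + circleMap 0 r θ • v)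
      (hdiff _ (hmem z hz _ (hcircle θ))).continuousAt (by fun_prop)
  have hs : ball z₀ (R / 4) ∈ 𝓝 z₀ := ball_mem_nhds _ (by positivity)
  have hCauchy : ∀ z ∈ ball z₀ (R / 4), fderiv ℂ f z v = (2 * Real.pi * Complex.I : ℂ)⁻¹ *
      ∫ θ in (0)..(2 * Real.pi), k θ * f (z + circleMap 0 r θ • v) := by
    intro z hz
    have hline : ∀ t : ℂ, HasDerivAt (fun t : ℂ => z + t • v) v t := fun t => by
      simpa using ((hasDerivAt_id t).smul_const v).const_add z
    have hφ : ∀ t ∈ closedBall (0 : ℂ) r,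
        HasDerivAt (fun t : ℂ => f (z + t • v)) (fderiv ℂ f (z + t • v) v) t := fun t ht =>
      (hdiff _ (hmem z hz t ht)).hasFDerivAt.comp_hasDerivAt t (hline t)
    have h := DifferentiableOn.deriv_eq_smul_circleIntegral hr₀
      (fun t ht => (hφ t ht).differentiableAt.differentiableWithinAt)
    rw [(hφ 0 (mem_closedBall_self hr₀.le)).deriv, zero_smul, add_zero] at h
    rw [eq_inv_mul_iff_mul_eq₀ Complex.two_pi_I_ne_zero, ← smul_eq_mul, ← h, circleIntegral]
    simp only [hk, smul_eq_mul, mul_assoc]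
  have hInt : DifferentiableAt ℂ
      (fun z => ∫ θ in (0)..(2 * Real.pi), k θ * f (z + circleMap 0 r θ • v)) z₀ := by
    refine (intervalIntegral.hasFDerivAt_integral_of_dominated_of_fderiv_le
      (F' := fun z θ => k θ • fderiv ℂ f (z + circleMap 0 r θ • v))
      (bound := fun _ => 1 / r * (2 / (R / 2))) hs ?_ ?_ ?_ ?_ ?_ ?_).differentiableAt
    · filter_upwards [hs] with z hz using (hF_cont z hz).aestronglyMeasurable
    · exact (hF_cont z₀ (mem_of_mem_nhds hs)).intervalIntegrable _ _
    · refine hk_cont.aestronglyMeasurable.smul (Measurable.aestronglyMeasurable ?_)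
      exact (measurable_fderiv ℂ f).comp
        (f := fun θ : ℝ => z₀ + circleMap 0 r θ • v) (by fun_prop)
    · refine Eventually.of_forall fun θ _ z hz => ?_
      rw [norm_smul, hk_norm]
      gcongr
      exact hfderiv _ (hmem z hz _ (hcircle θ))
    · exact intervalIntegrable_const
    · refine Eventually.of_forall fun θ _ z hz => ?_
      have h := (hdiff _ (hmem z hz _ (hcircle θ))).hasFDerivAt.comp z
        ((hasFDerivAt_id z).add_const (circleMap 0 r θ • v))
      simpa using! h.const_mul (k θ)
  exact (hInt.const_mul _).congr_of_eventuallyEq (eventuallyEq_of_mem hs hCauchy)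

variable {U : Set (ℂ × ℂ)} {f g : ℂ × ℂ → ℂ}

theorem differentiableOn_pdx (hU : IsOpen U) (hf : DifferentiableOn ℂ f U) :
    DifferentiableOn ℂ (pdx f) U :=
  differentiableOn_fderiv_apply hf hU (1, 0)

theorem differentiableOn_pdy (hU : IsOpen U) (hf : DifferentiableOn ℂ f U) :
    DifferentiableOn ℂ (pdy f) U :=
  differentiableOn_fderiv_apply hf hU (0, 1)

theorem eqOn_pdx (hU : IsOpen U) (h : EqOn f g U) : EqOn (pdx f) (pdx g) U := fun z hz => by
  rw [pdx, pdx, (h.eventuallyEq_of_mem (hU.mem_nhds hz)).fderiv_eq]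

theorem eqOn_pdy (hU : IsOpen U) (h : EqOn f g U) : EqOn (pdy f) (pdy g) U := fun z hz => by
  rw [pdy, pdy, (h.eventuallyEq_of_mem (hU.mem_nhds hz)).fderiv_eq]

/-- Mixed partial derivatives of a holomorphic function commute. -/
theorem eqOn_pdx_pdy_comm (hU : IsOpen U) (hf : DifferentiableOn ℂ f U) :
    EqOn (pdx (pdy f)) (pdy (pdx f)) U := by
  intro z hz
  have hfderiv : fderiv ℂ f = fun w => pdx f w • ContinuousLinearMap.fst ℂ ℂ ℂ +
      pdy f w • ContinuousLinearMap.snd ℂ ℂ ℂ := by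
    funext w
    ext <;> simp [pdx, pdy]
  have hX := ((differentiableOn_pdx hU hf).differentiableAt (hU.mem_nhds hz)).hasFDerivAt
  have hY := ((differentiableOn_pdy hU hf).differentiableAt (hU.mem_nhds hz)).hasFDerivAt
  have hf' := (hX.smul_const (ContinuousLinearMap.fst ℂ ℂ ℂ)).fun_add
    (hY.smul_const (ContinuousLinearMap.snd ℂ ℂ ℂ))
  have hev : ∀ᶠ w in 𝓝 z, HasFDerivAt f (fderiv ℂ f w) w := by
    filter_upwards [hU.mem_nhds hz] with w hw
    exact (hf.differentiableAt (hU.mem_nhds hw)).hasFDerivAt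
  have h := second_derivative_symmetric_of_eventually hev (hfderiv ▸ hf') (1, 0) (0, 1)
  simpa [pdx, pdy] using! h

/-- The form `dg / g` is closed where `g` is holomorphic and nonzero. -/
theorem pdx_logDeriv_eq_pdy_logDeriv (hU : IsOpen U) (hg : DifferentiableOn ℂ g U)
    {z : ℂ × ℂ} (hz : z ∈ U) (h₀ : g z ≠ 0) :
    pdx (fun w => pdy g w * (g w)⁻¹) z = pdy (fun w => pdx g w * (g w)⁻¹) z := by
  have hU' := hU.mem_nhds hz
  have hg' := (hg.differentiableAt hU').hasFDerivAt
  have hX := ((differentiableOn_pdx hU hg).differentiableAt hU').hasFDerivAt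
  have hY := ((differentiableOn_pdy hU hg).differentiableAt hU').hasFDerivAt
  have h := eqOn_pdx_pdy_comm hU hg hz
  have hinv : HasFDerivAt (fun w => (g w)⁻¹) (-(g z ^ 2)⁻¹ • fderiv ℂ g z) z :=
    (hasDerivAt_inv h₀).comp_hasFDerivAt z hg'
  refine (DFunLike.congr_fun (hY.fun_mul hinv).fderiv (1, 0)).trans
    (Eq.trans ?_ (DFunLike.congr_fun (hX.fun_mul hinv).fderiv (0, 1)).symm)
  simp only [pdx, pdy] at h
  simp [pdx, pdy, h]
  ring

/-- The derivative along `v` of the discriminant of the booklet web, as a function of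
`P = f_{xxx}`, `Q = f_{xxy}` and `R = f_{xyy}`. -/
theorem fderiv_booklet_discriminant {P Q R : ℂ × ℂ → ℂ} {z : ℂ × ℂ}
    (hP : DifferentiableAt ℂ P z) (hQ : DifferentiableAt ℂ Q z) (hR : DifferentiableAt ℂ R z)
    (v : ℂ × ℂ) :
    fderiv ℂ (fun z => -4 * R z * P z ^ 3 + 18 * R z * (2 * Q z) * P z * (-1)
        - 27 * R z ^ 2 * (-1) ^ 2 + (2 * Q z) ^ 2 * P z ^ 2 - 4 * (2 * Q z) ^ 3 * (-1)) z v =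
      (-12 * R z * P z ^ 2 - 36 * R z * Q z + 8 * Q z ^ 2 * P z) * fderiv ℂ P z v
      + (-36 * R z * P z + 8 * Q z * P z ^ 2 + 96 * Q z ^ 2) * fderiv ℂ Q z v
      + (-4 * P z ^ 3 - 36 * Q z * P z - 54 * R z) * fderiv ℂ R z v := by
  have hP := hP.hasFDerivAt
  have hQ := hQ.hasFDerivAt.const_mul 2
  have hR := hR.hasFDerivAt
  have h := ((((((hR.const_mul (-4)).fun_mul (hP.pow 3)).fun_add
    ((((hR.const_mul 18).fun_mul hQ).fun_mul hP).mul_const (-1))).fun_sub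
    (((hR.pow 2).const_mul 27).mul_const ((-1) ^ 2))).fun_add
    ((hQ.pow 2).fun_mul (hP.pow 2))).fun_sub
    (((hQ.pow 3).const_mul 4).mul_const (-1)))
  rw [h.fderiv]
  simp
  ring

/-- Proposition 3, corollary: the booklet 3-web `W₁` of a solution `f` of the
WDVV equation `f_{yyy} + f_{xxx}f_{xyy} − f_{xxy}² = 0` satisfies
`2·DA + ∂xΔ = 0`, `2·DB + ∂yΔ = 0` (i.e. `γ = −(1/2)dΔ/Δ`), and its Blaschke
curvature `∂x(B) − ∂y(A)` vanishes where `Δ ≠ 0`: the web is hexagonal. -/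
theorem wdvv_booklet_W1_hexagonal
    (U : Set (ℂ × ℂ)) (hU : IsOpen U)
    (f : ℂ × ℂ → ℂ) (hf : DifferentiableOn ℂ f U)
    (fxxx fxxy fxyy fyyy : ℂ × ℂ → ℂ)
    (hfxxx : fxxx = pdx (pdx (pdx f)))
    (hfxxy : fxxy = pdy (pdx (pdx f)))
    (hfxyy : fxyy = pdy (pdy (pdx f)))
    (hfyyy : fyyy = pdy (pdy (pdy f)))
    (hWDVV : ∀ z ∈ U, fyyy z + fxxx z * fxyy z - fxxy z ^ 2 = 0)
    (a₀ a₁ a₂ a₃ : ℂ × ℂ → ℂ)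
    (ha₀ : a₀ = fxyy) (ha₁ : a₁ = fun z => 2 * fxxy z)
    (ha₂ : a₂ = fxxx) (ha₃ : a₃ = fun _ => -1)
    (Δ : ℂ × ℂ → ℂ)
    (hΔ : Δ = fun z => -4 * a₀ z * a₂ z ^ 3 + 18 * a₀ z * a₁ z * a₂ z * a₃ z
        - 27 * a₀ z ^ 2 * a₃ z ^ 2 + a₁ z ^ 2 * a₂ z ^ 2 - 4 * a₁ z ^ 3 * a₃ z)
    (DA DB : ℂ × ℂ → ℂ)
    (hDA : DA = fun z =>
        a₃ z * (2 * a₂ z ^ 2 - 6 * a₁ z * a₃ z) * pdy a₀ z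
        + a₃ z * (9 * a₀ z * a₃ z - a₁ z * a₂ z) * (pdx a₀ z + pdy a₁ z)
        + a₃ z * (2 * a₁ z ^ 2 - 6 * a₀ z * a₂ z) * (pdx a₁ z + pdy a₂ z)
        + (4 * a₀ z * a₂ z ^ 2 - a₁ z ^ 2 * a₂ z - 3 * a₀ z * a₁ z * a₃ z) *
            (pdx a₂ z + pdy a₃ z)
        + (18 * a₀ z ^ 2 * a₃ z - 8 * a₀ z * a₁ z * a₂ z + 2 * a₁ z ^ 3) *
            pdx a₃ z)
    (hDB : DB = fun z =>
        (18 * a₀ z * a₃ z ^ 2 - 8 * a₁ z * a₂ z * a₃ z + 2 * a₂ z ^ 3) *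
            pdy a₀ z
        + (4 * a₁ z ^ 2 * a₃ z - a₁ z * a₂ z ^ 2 - 3 * a₀ z * a₂ z * a₃ z) *
            (pdx a₀ z + pdy a₁ z)
        + a₀ z * (2 * a₂ z ^ 2 - 6 * a₁ z * a₃ z) * (pdx a₁ z + pdy a₂ z)
        + a₀ z * (9 * a₀ z * a₃ z - a₁ z * a₂ z) * (pdx a₂ z + pdy a₃ z)
        + a₀ z * (2 * a₁ z ^ 2 - 6 * a₀ z * a₂ z) * pdx a₃ z) :
    (∀ z ∈ U, 2 * DA z + pdx Δ z = 0 ∧ 2 * DB z + pdy Δ z = 0) ∧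
    (∀ z ∈ U, Δ z ≠ 0 →
      pdx (fun w => DB w / Δ w) z - pdy (fun w => DA w / Δ w) z = 0) := by
  have hX : ∀ {g}, DifferentiableOn ℂ g U → DifferentiableOn ℂ (pdx g) U :=
    differentiableOn_pdx hU
  have hY : ∀ {g}, DifferentiableOn ℂ g U → DifferentiableOn ℂ (pdy g) U :=
    differentiableOn_pdy hU
  have hP : DifferentiableOn ℂ fxxx U := hfxxx ▸ hX (hX (hX hf))
  have hQ : DifferentiableOn ℂ fxxy U := hfxxy ▸ hY (hX (hX hf))
  have hR : DifferentiableOn ℂ fxyy U := hfxyy ▸ hY (hY (hX hf))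
  have hPQ : EqOn (pdy fxxx) (pdx fxxy) U := by
    rw [hfxxx, hfxxy]
    exact (eqOn_pdx_pdy_comm hU (hX (hX hf))).symm
  have hQR : EqOn (pdy fxxy) (pdx fxyy) U := by
    rw [hfxxy, hfxyy]
    exact ((eqOn_pdx_pdy_comm hU (hY (hX hf))).trans
      (eqOn_pdy hU (eqOn_pdx_pdy_comm hU (hX hf)))).symm
  have hRS : EqOn (pdy fxyy) (pdx fyyy) U := by
    rw [hfxyy, hfyyy]
    exact ((eqOn_pdx_pdy_comm hU (hY (hY hf))).trans (eqOn_pdy hU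
      ((eqOn_pdx_pdy_comm hU (hY hf)).trans (eqOn_pdy hU (eqOn_pdx_pdy_comm hU hf))))).symm
  have hS : EqOn (pdy fxyy) (fun z => 2 * fxxy z * pdx fxxy z - pdx fxxx z * fxyy z
      - fxxx z * pdx fxyy z) U := by
    intro z hz
    have hE : EqOn fyyy (fun w => fxxy w ^ 2 - fxxx w * fxyy w) U := fun w hw => by
      linear_combination hWDVV w hw
    have hU' := hU.mem_nhds hz
    rw [hRS hz, eqOn_pdx hU hE hz, pdx,
      (((hQ.differentiableAt hU').hasFDerivAt.pow 2).fun_sub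
        ((hP.differentiableAt hU').hasFDerivAt.fun_mul
          (hR.differentiableAt hU').hasFDerivAt)).fderiv]
    simp [pdx]
    ring
  clear hfxxx hfxxy hfxyy hfyyy
  subst a₀ a₁ a₂ a₃
  have hΔd : DifferentiableOn ℂ Δ U := by
    rw [hΔ]
    fun_prop
  have hconst : ∀ z v, fderiv ℂ (fun _ : ℂ × ℂ => (-1 : ℂ)) z v = 0 := fun z v => by simp
  have hmul : ∀ z ∈ U, ∀ v, fderiv ℂ (fun w => 2 * fxxy w) z v = 2 * fderiv ℂ fxxy z v := by
    intro z hz v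
    rw [((hQ.differentiableAt (hU.mem_nhds hz)).hasFDerivAt.const_mul 2).fderiv]
    simp
  have hmain : ∀ z ∈ U, 2 * DA z + pdx Δ z = 0 ∧ 2 * DB z + pdy Δ z = 0 := by
    intro z hz
    have hU' := hU.mem_nhds hz
    have hΔ' := fderiv_booklet_discriminant (hP.differentiableAt hU') (hQ.differentiableAt hU')
      (hR.differentiableAt hU')
    have h₁ := hPQ hz
    have h₂ := hQR hz
    have h₃ := hS hz
    simp only [pdx, pdy] at h₁ h₂ h₃
    simp only [hDA, hDB, hΔ, pdx, pdy, hΔ', hconst, hmul z hz, h₁, h₂, h₃]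
    constructor <;> ring
  refine ⟨hmain, fun z hz h₀ => ?_⟩
  have hB : EqOn (fun w => DB w / Δ w) (fun w => (-1 / 2) * (pdy Δ w * (Δ w)⁻¹)) U := fun w hw => by
    linear_combination (hmain w hw).2 / (2 * Δ w)
  have hA : EqOn (fun w => DA w / Δ w) (fun w => (-1 / 2) * (pdx Δ w * (Δ w)⁻¹)) U := fun w hw => by
    linear_combination (hmain w hw).1 / (2 * Δ w)
  have hU' := hU.mem_nhds hz
  have hΔz := hΔd.differentiableAt hU'
  have hlog := pdx_logDeriv_eq_pdy_logDeriv hU hΔd hz h₀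
  rw [eqOn_pdx hU hB hz, eqOn_pdy hU hA hz]
  simp only [pdx] at hlog ⊢
  simp only [pdy] at hlog ⊢
  have hXd : DifferentiableAt ℂ (fun w => fderiv ℂ Δ w (1, 0)) z := (hX hΔd).differentiableAt hU'
  have hYd : DifferentiableAt ℂ (fun w => fderiv ℂ Δ w (0, 1)) z := (hY hΔd).differentiableAt hU'
  rw [fderiv_const_mul (hYd.fun_mul (hΔz.fun_inv h₀)),
    fderiv_const_mul (hXd.fun_mul (hΔz.fun_inv h₀))]
  simp [hlog]
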